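/- arXiv:2208.02679 — 2 statements merged into one kernel-verified Lean document; each statement's English description precedes it below -/
import Mathlib

section
/- For every ξ ∈ ℝⁿ and every τ ∈ ℂ with τ ≠ μ|ξ|² and τ ≠ (2μ+λ)|ξ|², the matrix τ Iₙ − a₂(ξ) is invertible and its inverse (the leading symbol q₋₂ of the resolvent of the Navier–Lamé operator) is given explicitly by (τ Iₙ − a₂(ξ))⁻¹ = (τ − μ|ξ|²)⁻¹ Iₙ + (μ+λ) · [(τ − μ|ξ|²)(τ − (2μ+λ)|ξ|²)]⁻¹ ξξᵀ. -/
open Matrix BigOperators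

/-- The principal symbol of the Navier–Lamé operator:
`a₂(ξ) = μ|ξ|² Iₙ + (μ+λ) ξξᵀ`. -/
noncomputable def a2 (n : ℕ) (μ lam : ℝ) (ξ : Fin n → ℝ) : Matrix (Fin n) (Fin n) ℝ :=
  (μ * ∑ i, ξ i ^ 2) • (1 : Matrix (Fin n) (Fin n) ℝ) +
    (μ + lam) • Matrix.of fun j k => ξ j * ξ k

/-- Sherman–Morrison formula for a scalar matrix perturbed by a symmetric rank-one matrix. -/
theorem smul_one_sub_smul_vecMulVec_mul_inverse {ι K : Type*} [Fintype ι] [DecidableEq ι] [Field K]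
    (v : ι → K) (x c : K) (hx : x ≠ 0) (hy : x - c * (v ⬝ᵥ v) ≠ 0) :
    (x • (1 : Matrix ι ι K) - c • vecMulVec v v) *
      (x⁻¹ • (1 : Matrix ι ι K) + (c * (x * (x - c * (v ⬝ᵥ v)))⁻¹) • vecMulVec v v) = 1 := by
  have hP : vecMulVec v v * vecMulVec v v = (v ⬝ᵥ v) • vecMulVec v v := by
    rw [vecMulVec_mul_vecMulVec, vecMulVec_smul]
  simp only [sub_mul, mul_add, smul_mul_assoc, mul_smul_comm, one_mul, mul_one, hP, smul_smul]
  match_scalars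
  · field_simp
  · field_simp
    ring

/-- The complexified `τ Iₙ − a₂(ξ)` as a rank-one perturbation of a scalar matrix. -/
theorem smul_one_sub_a2_map (n : ℕ) (μ lam : ℝ) (ξ : Fin n → ℝ) (τ : ℂ) :
    τ • (1 : Matrix (Fin n) (Fin n) ℂ) - (a2 n μ lam ξ).map (fun r => (r : ℂ)) =
      (τ - ((μ * ∑ i, ξ i ^ 2 : ℝ) : ℂ)) • (1 : Matrix (Fin n) (Fin n) ℂ) -
        ((μ + lam : ℝ) : ℂ) • vecMulVec (fun i => (ξ i : ℂ)) (fun i => (ξ i : ℂ)) := by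
  ext j k
  by_cases h : j = k
  · simp [a2, vecMulVec_apply, h]
    ring
  · simp [a2, vecMulVec_apply, h]

/-- for τ off the two eigenvalues, τIₙ − a₂(ξ) is invertible, with the
resolvent symbol q₋₂ given explicitly by
(τIₙ − a₂(ξ))⁻¹ = (τ−μ|ξ|²)⁻¹ Iₙ + (μ+λ)[(τ−μ|ξ|²)(τ−(2μ+λ)|ξ|²)]⁻¹ ξξᵀ. -/
theorem a2_resolvent (n : ℕ) (hn : 1 ≤ n) (μ lam : ℝ) (hμ : 0 < μ) (hlam : 0 ≤ lam + μ)
    (ξ : Fin n → ℝ) (τ : ℂ)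
    (h1 : τ ≠ ((μ * ∑ i, ξ i ^ 2 : ℝ) : ℂ))
    (h2 : τ ≠ (((2 * μ + lam) * ∑ i, ξ i ^ 2 : ℝ) : ℂ)) :
    IsUnit (τ • (1 : Matrix (Fin n) (Fin n) ℂ) - (a2 n μ lam ξ).map (fun r => (r : ℂ))) ∧
    (τ • (1 : Matrix (Fin n) (Fin n) ℂ) - (a2 n μ lam ξ).map (fun r => (r : ℂ)))⁻¹
      = (τ - ((μ * ∑ i, ξ i ^ 2 : ℝ) : ℂ))⁻¹ • (1 : Matrix (Fin n) (Fin n) ℂ) +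
        (((μ + lam : ℝ) : ℂ) *
            ((τ - ((μ * ∑ i, ξ i ^ 2 : ℝ) : ℂ)) *
              (τ - (((2 * μ + lam) * ∑ i, ξ i ^ 2 : ℝ) : ℂ)))⁻¹) •
          Matrix.of (fun j k => ((ξ j : ℂ) * (ξ k : ℂ))) := by
  have hs : (τ - ((μ * ∑ i, ξ i ^ 2 : ℝ) : ℂ)) - ((μ + lam : ℝ) : ℂ) *
      ((fun i => (ξ i : ℂ)) ⬝ᵥ (fun i => (ξ i : ℂ))) =
        τ - (((2 * μ + lam) * ∑ i, ξ i ^ 2 : ℝ) : ℂ) := by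
    simp only [dotProduct, ← sq]
    push_cast
    ring
  have key := smul_one_sub_smul_vecMulVec_mul_inverse (fun i => (ξ i : ℂ)) _ ((μ + lam : ℝ) : ℂ)
    (sub_ne_zero.mpr h1) (by rw [hs]; exact sub_ne_zero.mpr h2)
  rw [hs, ← smul_one_sub_a2_map] at key
  exact ⟨.of_mul_eq_one _ key, inv_eq_right_inv key⟩
end

section
/- Method of images for the Dirichlet problem in the half-space: let u : ℝ × ℝⁿ → ℝⁿ be differentiable in t and twice differentiable in the space variable away from the hyperplane {yₙ = 0}, and suppose that for all t > 0: (i) ∂u/∂t (t,y) + (P u(t,·))(y) = 0 whenever yₙ > 0, and (ii) ∂u/∂t (t,y) + (P⁻ u(t,·))(y) = 0 whenever yₙ < 0. Define w(t,y) := u(t,y) − u(t, ς(y)). Then for all t > 0: ∂w/∂t (t,y) + (P w(t,·))(y) = 0 for every y with yₙ > 0, and w(t,y) = 0 for every y with yₙ = 0. -/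
open Matrix BigOperators

/-- The reflection `ς(x₁,…,x_{n−1},xₙ) = (x₁,…,x_{n−1},−xₙ)` of `ℝⁿ` across the
hyperplane `{xₙ = 0}` (the last coordinate is negated). -/
def varsigma (n : ℕ) (x : Fin n → ℝ) : Fin n → ℝ :=
  fun i => if (i : ℕ) = n - 1 then -x i else x i

/-- The sign `ε_j`: `ε_j = 1` for `j < n` and `ε_n = −1` (the last coordinate). -/
def eps (n : ℕ) (j : Fin n) : ℝ :=
  if (j : ℕ) = n - 1 then -1 else 1

/-- Second partial derivative `∂²f/∂x_j ∂x_k` of a real-valued function on `ℝⁿ`. -/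
noncomputable def pd2 {n : ℕ} (f : (Fin n → ℝ) → ℝ) (j k : Fin n) (x : Fin n → ℝ) : ℝ :=
  fderiv ℝ (fun y => fderiv ℝ f y (Pi.single k 1)) x (Pi.single j 1)

theorem varsigma_apply (n : ℕ) (x : Fin n → ℝ) (i : Fin n) :
    varsigma n x i = eps n i * x i := by
  unfold varsigma eps
  split_ifs <;> simp

theorem eps_mul_self (n : ℕ) (j : Fin n) : eps n j * eps n j = 1 := by
  unfold eps
  split_ifs <;> norm_num

theorem varsigma_involutive (n : ℕ) : Function.Involutive (varsigma n) := fun x => by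
  ext i
  rw [varsigma_apply, varsigma_apply, ← mul_assoc, eps_mul_self, one_mul]

/-- The reflection `varsigma` as a continuous linear automorphism of `ℝⁿ`. -/
noncomputable def varsigmaEquiv (n : ℕ) : (Fin n → ℝ) ≃L[ℝ] (Fin n → ℝ) :=
  (LinearEquiv.ofInvolutive
    { toFun := varsigma n
      map_add' := fun x y => by ext i; simp only [varsigma_apply, Pi.add_apply]; ring
      map_smul' := fun c x => by
        ext i
        simp only [varsigma_apply, Pi.smul_apply, smul_eq_mul, RingHom.id_apply]
        ring }
    (varsigma_involutive n)).toContinuousLinearEquiv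

theorem varsigmaEquiv_apply (n : ℕ) (x : Fin n → ℝ) : varsigmaEquiv n x = varsigma n x := rfl

theorem varsigmaEquiv_single (n : ℕ) (k : Fin n) :
    varsigmaEquiv n (Pi.single k 1) = eps n k • Pi.single k (1 : ℝ) := by
  ext i
  rw [varsigmaEquiv_apply, varsigma_apply, Pi.smul_apply, smul_eq_mul]
  rcases eq_or_ne i k with rfl | h
  · rfl
  · simp [h]

theorem fderiv_comp_varsigma_single {n : ℕ} (f : (Fin n → ℝ) → ℝ) (k : Fin n)
    (x : Fin n → ℝ) :
    fderiv ℝ (fun y => f (varsigma n y)) x (Pi.single k 1) =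
      eps n k * fderiv ℝ f (varsigma n x) (Pi.single k 1) := by
  have h := (varsigmaEquiv n).comp_right_fderiv (f := f) (x := x)
  change fderiv ℝ (fun y => f (varsigma n y)) x = _ at h
  rw [h, ContinuousLinearMap.comp_apply, ContinuousLinearEquiv.coe_coe, varsigmaEquiv_single,
    map_smul, smul_eq_mul, varsigmaEquiv_apply]

theorem pd2_comp_varsigma {n : ℕ} (f : (Fin n → ℝ) → ℝ) (j k : Fin n) (x : Fin n → ℝ) :
    pd2 (fun y => f (varsigma n y)) j k x = eps n j * eps n k * pd2 f j k (varsigma n x) := by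
  unfold pd2
  simp only [fderiv_comp_varsigma_single]
  have h := congrFun (fderiv_const_smul_field (𝕜 := ℝ)
    (f := fun y => fderiv ℝ f (varsigma n y) (Pi.single k 1)) (eps n k)) x
  change fderiv ℝ (fun y => eps n k * fderiv ℝ f (varsigma n y) (Pi.single k 1)) x = _ at h
  rw [h, Pi.smul_apply, _root_.smul_apply, smul_eq_mul,
    fderiv_comp_varsigma_single (fun y => fderiv ℝ f y (Pi.single k 1))]
  ring

theorem pd2_sub {n : ℕ} {f g : (Fin n → ℝ) → ℝ} {x : Fin n → ℝ}
    (hf : ContDiffAt ℝ 2 f x) (hg : ContDiffAt ℝ 2 g x) (j k : Fin n) :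
    pd2 (fun y => f y - g y) j k x = pd2 f j k x - pd2 g j k x := by
  have eventually_diff : ∀ {h : (Fin n → ℝ) → ℝ}, ContDiffAt ℝ 2 h x →
      ∀ᶠ y in nhds x, DifferentiableAt ℝ h y := fun hh =>
    (hh.eventually (by simp)).mono fun y hy => hy.differentiableAt (by simp)
  have partial_diff : ∀ {h : (Fin n → ℝ) → ℝ}, ContDiffAt ℝ 2 h x →
      DifferentiableAt ℝ (fun y => fderiv ℝ h y (Pi.single k 1)) x := fun hh =>
    ((hh.fderiv_right (m := 1) (by norm_num)).differentiableAt (by simp)).clm_apply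
      (differentiableAt_const _)
  have heq : (fun y => fderiv ℝ (fun z => f z - g z) y (Pi.single k 1)) =ᶠ[nhds x]
      fun y => fderiv ℝ f y (Pi.single k 1) - fderiv ℝ g y (Pi.single k 1) := by
    filter_upwards [eventually_diff hf, eventually_diff hg] with y hy hy'
    rw [fderiv_fun_sub hy hy', _root_.sub_apply]
  unfold pd2
  rw [heq.fderiv_eq, fderiv_fun_sub (partial_diff hf) (partial_diff hg),
    _root_.sub_apply]

/-- method of images for the Dirichlet problem in the half-space. If u solves
∂u/∂t + Pu = 0 for yₙ > 0 and ∂u/∂t + P⁻u = 0 for yₙ < 0 (with the stated regularity away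
from the hyperplane {yₙ = 0}), then w(t,y) := u(t,y) − u(t,ς(y)) solves ∂w/∂t + Pw = 0 in
the upper half-space and vanishes on the boundary {yₙ = 0}. -/
theorem method_of_images_dirichlet (n : ℕ) (hn : 1 ≤ n) (μ lam : ℝ) (hμ : 0 < μ)
    (hlam : 0 ≤ lam + μ) (u : ℝ → (Fin n → ℝ) → (Fin n → ℝ))
    (hreg : ∀ t : ℝ, 0 < t → ∀ y : Fin n → ℝ, y ⟨n - 1, by omega⟩ ≠ 0 →
      ContDiffAt ℝ 2 (u t) y ∧ ∀ j : Fin n, DifferentiableAt ℝ (fun s => u s y j) t)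
    (hupper : ∀ t : ℝ, 0 < t → ∀ y : Fin n → ℝ, 0 < y ⟨n - 1, by omega⟩ → ∀ j : Fin n,
      deriv (fun s => u s y j) t +
        (-μ * (∑ k, pd2 (fun x => u t x j) k k y)
          - (lam + μ) * (∑ k, pd2 (fun x => u t x k) j k y)) = 0)
    (hlower : ∀ t : ℝ, 0 < t → ∀ y : Fin n → ℝ, y ⟨n - 1, by omega⟩ < 0 → ∀ j : Fin n,
      deriv (fun s => u s y j) t +
        (-μ * (∑ k, pd2 (fun x => u t x j) k k y)
          - (lam + μ) *
              (∑ k, eps n j * eps n k * pd2 (fun x => u t x k) j k y)) = 0) :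
    (∀ t : ℝ, 0 < t → ∀ y : Fin n → ℝ, 0 < y ⟨n - 1, by omega⟩ → ∀ j : Fin n,
      deriv (fun s => (u s y - u s (varsigma n y)) j) t +
        (-μ * (∑ k, pd2 (fun x => (u t x - u t (varsigma n x)) j) k k y)
          - (lam + μ) * (∑ k, pd2 (fun x => (u t x - u t (varsigma n x)) k) j k y)) = 0) ∧
    (∀ t : ℝ, 0 < t → ∀ y : Fin n → ℝ, y ⟨n - 1, by omega⟩ = 0 →
      u t y - u t (varsigma n y) = 0) := by
  refine ⟨fun t ht y hy j => ?_, fun t _ y hy => ?_⟩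
  · have hσ : varsigma n y ⟨n - 1, by omega⟩ < 0 := by simpa [varsigma] using hy
    obtain ⟨hC, hD⟩ := hreg t ht y hy.ne'
    obtain ⟨hC', hD'⟩ := hreg t ht _ hσ.ne
    have hCσ : ContDiffAt ℝ 2 (fun x => u t (varsigma n x)) y :=
      ContDiffAt.comp y hC' (varsigmaEquiv n).contDiff.contDiffAt
    have hpd : ∀ i a b, pd2 (fun x => (u t x - u t (varsigma n x)) i) a b y =
        pd2 (fun x => u t x i) a b y -
          eps n a * eps n b * pd2 (fun x => u t x i) a b (varsigma n y) := fun i a b => by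
      rw [← pd2_comp_varsigma (fun x => u t x i)]
      exact pd2_sub (contDiffAt_pi.1 hC i) (contDiffAt_pi.1 hCσ i) a b
    have hderiv : deriv (fun s => (u s y - u s (varsigma n y)) j) t =
        deriv (fun s => u s y j) t - deriv (fun s => u s (varsigma n y) j) t :=
      deriv_fun_sub (hD j) (hD' j)
    simp only [hderiv, hpd, eps_mul_self, one_mul, Finset.sum_sub_distrib]
    linear_combination hupper t ht y hy j - hlower t ht _ hσ j
  · have hfix : varsigma n y = y := by
      ext i
      unfold varsigma
      split_ifs with h
      · have hi : i = ⟨n - 1, by omega⟩ := Fin.ext h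
        rw [hi, hy, neg_zero]
      · rfl
    rw [hfix, sub_self]
end
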